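/- Let λ₁ > λ₂ > ⋯ > λₙ > 0 be real numbers and let L be an n×n complex Hermitian matrix whose eigenvalues, with multiplicity, are λ₁, …, λₙ (equivalently, L = g·diag(λ₁,…,λₙ)·g* for some unitary g). Then the following are equivalent: (i) there exists g ∈ U_n^{>0} with L = g·diag(λ₁,…,λₙ)·g*; (ii) there exists an integer m ≥ 1 such that every minor Δ_{I,J}(L^m) of every order is a positive real number; (iii) for all sufficiently large integers m, every minor of L^m of every order is a positive real number. -/

import Mathlib

open Matrix Finset

/-- The minor of a square matrix `g` on row set `I` and column set `J`
(rows and columns listed in increasing order); defined to be `0` if `I` and `J`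
have different cardinalities. -/
noncomputable def minorOn {R : Type} [CommRing R] {n : ℕ} (g : Matrix (Fin n) (Fin n) R)
    (I J : Finset (Fin n)) : R :=
  if h : J.card = I.card then
    Matrix.det (Matrix.of fun a b : Fin I.card =>
      g ((I.orderIsoOfFin rfl a : Fin n)) ((J.orderIsoOfFin h b : Fin n)))
  else 0

/-- The left-justified minor `Δ_I(g)`: the minor on rows `I` and the first `|I|` columns. -/
noncomputable def leftMinor {R : Type} [CommRing R] {n : ℕ} (g : Matrix (Fin n) (Fin n) R)
    (I : Finset (Fin n)) : R :=
  minorOn g I (Finset.univ.filter fun j : Fin n => (j : ℕ) < I.card)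

/-- A complex number is a positive real. -/
def IsPosReal (z : ℂ) : Prop := 0 < z.re ∧ z.im = 0

/-- A complex number is a nonnegative real. -/
def IsNonnegReal (z : ℂ) : Prop := 0 ≤ z.re ∧ z.im = 0

/-- The diagonal sign matrix `δ_n = diag(1, −1, 1, …, (−1)^{n−1})`. -/
noncomputable def deltaMat (n : ℕ) : Matrix (Fin n) (Fin n) ℂ :=
  Matrix.diagonal fun i : Fin n => (-1 : ℂ) ^ (i : ℕ)

/-- The totally positive part `U_n^{>0}` of the unitary group: unitary matrices all of
whose left-justified minors are positive real numbers. -/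
def UnitaryTP (n : ℕ) : Set (Matrix (Fin n) (Fin n) ℂ) :=
  {g | g.conjTranspose * g = 1 ∧ ∀ I : Finset (Fin n), IsPosReal (leftMinor g I)}


/-- Compound matrix, indexed by order embeddings. -/
noncomputable def compd {n : ℕ} (k : ℕ) (A : Matrix (Fin n) (Fin n) ℂ) :
    Matrix (Fin k ↪o Fin n) (Fin k ↪o Fin n) ℂ :=
  Matrix.of fun e f => (A.submatrix e f).det

theorem det_mul_rect {k n : ℕ} (A : Matrix (Fin k) (Fin n) ℂ) (B : Matrix (Fin n) (Fin k) ℂ) :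
    (A * B).det = ∑ p : Fin k → Fin n, (∏ i, A i (p i)) * (B.submatrix p id).det := by
  have h := MultilinearMap.map_sum
    (Matrix.detRowAlternating (n := Fin k) (R := ℂ)).toMultilinearMap
    (α := fun _ => Fin n) (fun i j => A i j • B j)
  have h1 : (fun i => ∑ j, A i j • B j) = A * B := by
    ext i l
    simp [Matrix.mul_apply]
  rw [h1] at h
  refine h.trans (Finset.sum_congr rfl fun p _ => ?_)
  exact (MultilinearMap.map_smul_univ
    (Matrix.detRowAlternating (n := Fin k) (R := ℂ)).toMultilinearMap
    (fun i => A i (p i)) (fun i => B (p i)))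

theorem emb_eq_of_comp {k n : ℕ} {e f : Fin k ↪o Fin n} {s t : Equiv.Perm (Fin k)}
    (h : (e ∘ s : Fin k → Fin n) = f ∘ t) : e = f ∧ s = t := by
  have h1 : Set.range e = Set.range f := by
    have := congrArg Set.range h
    rwa [Set.range_comp, Set.range_comp, s.range_eq_univ, t.range_eq_univ, Set.image_univ,
      Set.image_univ] at this
  have h2 : e = f := DFunLike.coe_injective ((StrictMono.range_inj e.strictMono f.strictMono).1 h1)
  subst h2
  refine ⟨rfl, Equiv.ext fun x => e.injective (congrFun h x)⟩

theorem cauchy_binet {k n : ℕ} (A : Matrix (Fin k) (Fin n) ℂ) (B : Matrix (Fin n) (Fin k) ℂ) :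
    (A * B).det = ∑ e : Fin k ↪o Fin n, (A.submatrix id e).det * (B.submatrix e id).det := by
  rw [det_mul_rect]
  have h : ∑ q : (Fin k ↪o Fin n) × Equiv.Perm (Fin k),
      (∏ i, A i (q.1 (q.2 i))) * (B.submatrix (q.1 ∘ q.2) id).det =
      ∑ p : Fin k → Fin n, (∏ i, A i (p i)) * (B.submatrix p id).det := by
    refine Finset.sum_of_injOn (fun q => q.1 ∘ q.2) ?_ (by simp) ?_ (by simp)
    · rintro ⟨e, s⟩ - ⟨f, t⟩ - h
      obtain ⟨rfl, rfl⟩ := emb_eq_of_comp h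
      rfl
    · intro p _ hp
      by_cases hinj : Function.Injective p
      · exfalso
        apply hp
        have hm : StrictMono (p ∘ Tuple.sort p) :=
          (Tuple.monotone_sort p).strictMono_of_injective (hinj.comp (Tuple.sort p).injective)
        refine ⟨(OrderEmbedding.ofStrictMono _ hm, (Tuple.sort p)⁻¹), by simp, ?_⟩
        ext x
        simp
      · simp only [Function.Injective, not_forall] at hinj
        obtain ⟨i, j, hij, hne⟩ := hinj
        rw [Matrix.det_zero_of_row_eq hne, mul_zero]
        ext l
        simp [hij]
  rw [← h, Fintype.sum_prod_type]
  refine Finset.sum_congr rfl fun e _ => ?_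
  have h2 : ∀ s : Equiv.Perm (Fin k), (B.submatrix (e ∘ s) id).det =
      (Equiv.Perm.sign s : ℤ) * (B.submatrix e id).det := fun s => by
    rw [← Matrix.det_permute]; rfl
  simp only [h2]
  rw [← Matrix.det_transpose (A.submatrix id e), Matrix.det_apply' (A.submatrix id e)ᵀ, Finset.sum_mul]
  refine Finset.sum_congr rfl fun s _ => ?_
  simp only [Matrix.transpose_apply, Matrix.submatrix_apply, id]
  ring

theorem compd_mul {n : ℕ} (k : ℕ) (A B : Matrix (Fin n) (Fin n) ℂ) :
    compd k (A * B) = compd k A * compd k B := by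
  ext e f
  have := cauchy_binet (A.submatrix e id) (B.submatrix id f)
  rw [Matrix.mul_apply]
  exact this

theorem compd_conjTranspose {n : ℕ} (k : ℕ) (A : Matrix (Fin n) (Fin n) ℂ) :
    compd k Aᴴ = (compd k A)ᴴ := by
  ext e f
  simp only [compd, Matrix.of_apply, Matrix.conjTranspose_apply]
  rw [← Matrix.det_conjTranspose]
  rfl

theorem compd_diagonal {n : ℕ} (k : ℕ) (d : Fin n → ℂ) :
    compd k (Matrix.diagonal d) = Matrix.diagonal fun e => ∏ i, d (e i) := by
  ext e f
  simp only [compd, Matrix.of_apply]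
  by_cases h : e = f
  · subst h
    rw [Matrix.submatrix_diagonal _ _ e.injective, Matrix.det_diagonal, Matrix.diagonal_apply_eq]
    rfl
  · rw [Matrix.diagonal_apply_ne _ h]
    have : ∃ a, e a ∉ Set.range f := by
      by_contra! hc
      have hc' : ∀ a, ∃ b, f b = e a := hc
      choose s hs using hc'
      have hsi : Function.Injective s := fun a b hab => e.injective (by rw [← hs, ← hs, hab])
      have hb := Finite.injective_iff_bijective.1 hsi
      apply h
      refine (emb_eq_of_comp (s := 1) (t := Equiv.ofBijective s hb) ?_).1
      ext x
      simp [hs]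
    obtain ⟨a, ha⟩ := this
    refine Matrix.det_eq_zero_of_row_eq_zero a fun b => ?_
    exact Matrix.diagonal_apply_ne _ fun hh => ha ⟨b, hh.symm⟩

theorem compd_one {n : ℕ} (k : ℕ) : compd k (1 : Matrix (Fin n) (Fin n) ℂ) = 1 := by
  rw [← Matrix.diagonal_one, compd_diagonal]
  simp

theorem minorOn_eq {n : ℕ} (g : Matrix (Fin n) (Fin n) ℂ) (I J : Finset (Fin n)) {k : ℕ}
    (hI : I.card = k) (hJ : J.card = k) :
    minorOn g I J = compd k g (I.orderEmbOfFin hI) (J.orderEmbOfFin hJ) := by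
  subst hI
  rw [minorOn, dif_pos hJ]
  rfl

theorem emb_exists {n k : ℕ} (e : Fin k ↪o Fin n) :
    ∃ (I : Finset (Fin n)) (h : I.card = k), e = I.orderEmbOfFin h := by
  refine ⟨Finset.univ.map e.toEmbedding, by simp, ?_⟩
  apply DFunLike.coe_injective
  apply Finset.orderEmbOfFin_unique
  · simp
  · exact e.strictMono

theorem emb_card_le {n k : ℕ} (e : Fin k ↪o Fin n) : k ≤ n := by
  simpa using Fintype.card_le_of_embedding e.toEmbedding

theorem leftMinor_eq {n : ℕ} (g : Matrix (Fin n) (Fin n) ℂ) (I : Finset (Fin n)) {k : ℕ}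
    (hI : I.card = k) (hk : k ≤ n) :
    leftMinor g I = compd k g (I.orderEmbOfFin hI) (Fin.castLEOrderEmb hk) := by
  have hc : (Finset.univ.filter fun j : Fin n => (j : ℕ) < I.card).card = k := by
    rw [hI, Fin.card_filter_val_lt]; simpa using hk
  rw [leftMinor, minorOn_eq g I _ hI hc]
  congr 1
  apply DFunLike.coe_injective
  symm
  apply Finset.orderEmbOfFin_unique
  · intro x; simp [hI]
  · exact (Fin.castLEOrderEmb hk).strictMono

theorem emb_ge {n k : ℕ} (e : Fin k ↪o Fin n) (hk : k ≤ n) (a : Fin k) : Fin.castLE hk a ≤ e a := by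
  obtain ⟨a, ha⟩ := a
  induction a with
  | zero => exact Nat.zero_le _
  | succ a ih =>
    have h1 := ih (by omega)
    have h2 : e ⟨a, by omega⟩ < e ⟨a+1, ha⟩ := e.strictMono (by simp)
    rw [Fin.le_def] at *
    rw [Fin.lt_def] at h2
    simp only [Fin.val_castLE] at *
    omega

theorem prod_le_first {n k : ℕ} (lam : Fin n → ℝ) (hanti : StrictAnti lam) (hpos : ∀ i, 0 < lam i)
    (e : Fin k ↪o Fin n) (hk : k ≤ n) :
    ∏ i, lam (e i) ≤ ∏ i, lam (Fin.castLEOrderEmb hk i) :=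
  Finset.prod_le_prod (fun i _ => (hpos _).le) fun i _ => hanti.antitone (emb_ge e hk i)

theorem prod_lt_first {n k : ℕ} (lam : Fin n → ℝ) (hanti : StrictAnti lam) (hpos : ∀ i, 0 < lam i)
    (e : Fin k ↪o Fin n) (hk : k ≤ n) (hne : e ≠ Fin.castLEOrderEmb hk) :
    ∏ i, lam (e i) < ∏ i, lam (Fin.castLEOrderEmb hk i) := by
  refine Finset.prod_lt_prod (fun _ _ => (hpos _)) (fun i _ => hanti.antitone (emb_ge e hk i)) ?_
  by_contra! hc
  apply hne
  ext i
  have h1 := hanti.le_iff_ge.1 (hc i (Finset.mem_univ _))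
  exact congrArg Fin.val (le_antisymm h1 (emb_ge e hk i))

theorem compd_pow {n : ℕ} (k m : ℕ) (lam : Fin n → ℝ) (g L : Matrix (Fin n) (Fin n) ℂ)
    (hg : gᴴ * g = 1) (hL : L = g * Matrix.diagonal (fun i => (lam i : ℂ)) * gᴴ) :
    compd k (L ^ m) = compd k g *
      Matrix.diagonal (fun e : Fin k ↪o Fin n => (((∏ i, lam (e i)) ^ m : ℝ) : ℂ)) *
      (compd k g)ᴴ := by
  have h : L ^ m = g * Matrix.diagonal (fun i => (lam i : ℂ) ^ m) * gᴴ := by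
    induction m with
    | zero =>
      simp [mul_eq_one_comm.1 hg]
    | succ m ih =>
      rw [pow_succ, ih, hL]
      calc _ = g * Matrix.diagonal (fun i => (lam i : ℂ) ^ m) * (gᴴ * g) *
            Matrix.diagonal (fun i => (lam i : ℂ)) * gᴴ := by simp only [Matrix.mul_assoc]
        _ = _ := by
          rw [hg, Matrix.mul_one, Matrix.mul_assoc g, Matrix.diagonal_mul_diagonal]
          simp only [pow_succ]
  rw [h, compd_mul, compd_mul, compd_conjTranspose, compd_diagonal]
  congr 3
  ext e
  push_cast
  rw [Finset.prod_pow]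

theorem perron_phase {ι : Type} [Fintype ι] [DecidableEq ι] (U P : Matrix ι ι ℂ) (mu : ι → ℝ)
    (o : ι) (hmu : ∀ i, mu i ≤ mu o) (ho : 0 < mu o) (hU : Uᴴ * U = 1)
    (hP : P = U * Matrix.diagonal (fun i => (mu i : ℂ)) * Uᴴ)
    (hpos : ∀ i j, IsPosReal (P i j)) :
    ∃ c : ℂ, ‖c‖ = 1 ∧ ∀ i, ∃ r : ℝ, 0 < r ∧ U i o = c * r := by
  have hU' : U * Uᴴ = 1 := mul_eq_one_comm.1 hU
  set v : ι → ℂ := fun i => U i o with hv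
  set x : ι → ℂ := fun i => (‖v i‖ : ℂ) with hx
  set Q : ι → ι → ℝ := fun i j => (P i j).re with hQ
  have hQP : ∀ i j, P i j = (Q i j : ℂ) := fun i j => by
    apply Complex.ext <;> simp [hQ, (hpos i j).2]
  have hQpos : ∀ i j, 0 < Q i j := fun i j => (hpos i j).1
  -- eigenvector
  have heig : P *ᵥ v = (mu o : ℂ) • v := by
    have h1 : v = U *ᵥ Pi.single o 1 := by
      ext i; simp [hv]
    have h2 : P * U = U * Matrix.diagonal (fun i => (mu i : ℂ)) := by
      rw [hP, Matrix.mul_assoc, hU, Matrix.mul_one]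
    rw [h1, Matrix.mulVec_mulVec, h2]
    ext i
    simp [mul_comm]
  -- general quadratic form bound
  have hquad : (star x ⬝ᵥ P *ᵥ x).re ≤ mu o * ∑ i, ‖v i‖ ^ 2 := by
    set y := Uᴴ *ᵥ x with hy
    have e1 : star x ⬝ᵥ P *ᵥ x = ∑ i, ((mu i * ‖y i‖ ^ 2 : ℝ) : ℂ) := by
      have : star x ᵥ* U = star y := by
        rw [hy, Matrix.star_mulVec, Matrix.conjTranspose_conjTranspose]
      rw [hP, ← Matrix.mulVec_mulVec, ← Matrix.mulVec_mulVec, Matrix.dotProduct_mulVec, this]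
      simp only [dotProduct, Matrix.mulVec_diagonal, Pi.star_apply]
      refine Finset.sum_congr rfl fun i _ => ?_
      have := Complex.conj_mul' (y i)
      push_cast
      rw [← this, ← hy]
      simp only [RCLike.star_def]
      ring
    have e2 : ((∑ i, ‖v i‖ ^ 2 : ℝ) : ℂ) = ((∑ i, ‖y i‖ ^ 2 : ℝ) : ℂ) := by
      have h1 : star y ⬝ᵥ y = star x ⬝ᵥ x := by
        have : star x ᵥ* U = star y := by
          rw [hy, Matrix.star_mulVec, Matrix.conjTranspose_conjTranspose]
        rw [← this, hy, ← Matrix.dotProduct_mulVec, Matrix.mulVec_mulVec, hU', Matrix.one_mulVec]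
      simp only [dotProduct, Pi.star_apply, RCLike.star_def, Complex.conj_mul'] at h1
      push_cast
      rw [h1]
      simp [hx]
    have e2' := Complex.ofReal_injective e2
    rw [e1, e2', ← Complex.ofReal_sum, Complex.ofReal_re, Finset.mul_sum]
    exact Finset.sum_le_sum fun i _ => mul_le_mul_of_nonneg_right (hmu i) (by positivity)
  have hxq : (star x ⬝ᵥ P *ᵥ x).re = ∑ i, ∑ j, Q i j * (‖v i‖ * ‖v j‖) := by
    simp only [dotProduct, Matrix.mulVec, Pi.star_apply, hQP, hx, RCLike.star_def,
      Complex.conj_ofReal, Finset.mul_sum, Complex.re_sum, ← Complex.ofReal_mul,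
      Complex.ofReal_re]
    exact Finset.sum_congr rfl fun i _ => Finset.sum_congr rfl fun j _ => by ring
  have hvq : mu o * ∑ i, ‖v i‖ ^ 2 = ∑ i, ∑ j, Q i j * (star (v i) * v j).re := by
    have h1 : star v ⬝ᵥ P *ᵥ v = ((mu o * ∑ i, ‖v i‖ ^ 2 : ℝ) : ℂ) := by
      rw [heig, dotProduct_smul]
      simp [dotProduct, Complex.conj_mul']
    rw [← Complex.ofReal_re (mu o * ∑ i, ‖v i‖ ^ 2), ← h1]
    simp only [dotProduct, Matrix.mulVec, Pi.star_apply, hQP, Finset.mul_sum, Complex.re_sum]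
    refine Finset.sum_congr rfl fun i _ => Finset.sum_congr rfl fun j _ => ?_
    rw [← Complex.re_ofReal_mul]
    congr 1
    ring
  have hle : ∀ i j, (star (v i) * v j).re ≤ ‖v i‖ * ‖v j‖ := fun i j => by
    refine (Complex.re_le_norm _).trans ?_
    simp
  have hzero : ∀ i j, (star (v i) * v j).re = ‖v i‖ * ‖v j‖ := by
    have hs : ∑ i, ∑ j, Q i j * (‖v i‖ * ‖v j‖ - (star (v i) * v j).re) = 0 := by
      have hnn : 0 ≤ ∑ i, ∑ j, Q i j * (‖v i‖ * ‖v j‖ - (star (v i) * v j).re) :=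
        Finset.sum_nonneg fun i _ => Finset.sum_nonneg fun j _ =>
          mul_nonneg (hQpos i j).le (sub_nonneg.2 (hle i j))
      refine le_antisymm ?_ hnn
      simp only [mul_sub, Finset.sum_sub_distrib]
      linarith
    intro i j
    rw [Finset.sum_eq_zero_iff_of_nonneg (fun i _ => Finset.sum_nonneg fun j _ =>
          mul_nonneg (hQpos i j).le (sub_nonneg.2 (hle i j)))] at hs
    have h1 := hs i (Finset.mem_univ _)
    rw [Finset.sum_eq_zero_iff_of_nonneg (fun j _ =>
          mul_nonneg (hQpos i j).le (sub_nonneg.2 (hle i j)))] at h1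
    have h2 := h1 j (Finset.mem_univ _)
    have := (mul_eq_zero.1 h2).resolve_left (hQpos i j).ne'
    linarith
  -- nonzero entry
  have hne : ∃ a, v a ≠ 0 := by
    by_contra! hc
    have := congrFun (congrFun hU o) o
    rw [Matrix.mul_apply, Matrix.one_apply_eq] at this
    have hc' : ∀ a, U a o = 0 := hc
    simp [hc'] at this
  obtain ⟨a, ha⟩ := hne
  have hna : 0 < ‖v a‖ := norm_pos_iff.2 ha
  have hnac : (‖v a‖ : ℂ) ≠ 0 := by exact_mod_cast hna.ne'
  set c : ℂ := v a / ‖v a‖ with hc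
  have hc1 : ‖c‖ = 1 := by
    rw [hc, norm_div, Complex.norm_real, norm_norm, div_self hna.ne']
  have hc0 : c ≠ 0 := by
    intro h; rw [h] at hc1; simp at hc1
  have hvc : ∀ i, v i = c * x i := by
    intro i
    have h1 : star (v a) * v i = ((‖v a‖ * ‖v i‖ : ℝ) : ℂ) := by
      have hn : ‖star (v a) * v i‖ = ‖v a‖ * ‖v i‖ := by simp
      have hr := hzero a i
      have h3 : (star (v a) * v i).re = ‖star (v a) * v i‖ := hr.trans hn.symm
      have h4 := (Complex.re_eq_norm.1 h3)
      have h5 := Complex.eq_re_of_ofReal_le (r := 0) (by simpa using h4)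
      exact h5.trans (congrArg Complex.ofReal hr)
    have h2 : v a * star (v a) = (‖v a‖ : ℂ) ^ 2 := by
      simpa using Complex.mul_conj' (v a)
    have h3 : (‖v a‖ : ℂ) ^ 2 * v i = v a * (‖v a‖ * x i) := by
      rw [← h2, mul_assoc, h1]; push_cast; rfl
    rw [hc]
    field_simp
    have : (‖v a‖ : ℂ) * ((‖v a‖ : ℂ) * v i) = (‖v a‖ : ℂ) * (v a * x i) := by
      linear_combination h3
    linear_combination mul_left_cancel₀ hnac this
  have hxe : ∀ i, ∑ j, Q i j * ‖v j‖ = mu o * ‖v i‖ := by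
    intro i
    have h1 := congrFun heig i
    simp only [Matrix.mulVec, dotProduct, Pi.smul_apply, smul_eq_mul, hQP] at h1
    simp only [hvc] at h1
    have h2 : c * ∑ j, (Q i j : ℂ) * x j = c * (mu o * x i) := by
      rw [Finset.mul_sum]
      refine Eq.trans (Finset.sum_congr rfl fun j _ => ?_) (h1.trans ?_) <;> ring
    have h3 := mul_left_cancel₀ hc0 h2
    simp only [hx] at h3
    exact_mod_cast h3
  refine ⟨c, hc1, fun i => ⟨‖v i‖, ?_, hvc i⟩⟩
  have h1 : 0 < ∑ j, Q i j * ‖v j‖ :=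
    Finset.sum_pos' (fun j _ => mul_nonneg (hQpos i j).le (norm_nonneg _))
      ⟨a, Finset.mem_univ _, mul_pos (hQpos i a) hna⟩
  rw [hxe] at h1
  exact pos_of_mul_pos_right h1 ho.le

theorem eq_one_of_left {n : ℕ} (h : Matrix (Fin n) (Fin n) ℂ) (hu : hᴴ * h = 1)
    (hm : ∀ k (hk : k ≤ n) (e : Fin k ↪o Fin n), compd k h e (Fin.castLEOrderEmb hk) =
      compd k 1 e (Fin.castLEOrderEmb hk)) : h = 1 := by
  have hu' : h * hᴴ = 1 := mul_eq_one_comm.1 hu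
  have key : ∀ k (hk : k < n) (i : Fin n), h i ⟨k, hk⟩ = (1 : Matrix (Fin n) (Fin n) ℂ) i ⟨k, hk⟩ := by
    intro k
    induction k using Nat.strong_induction_on with
    | _ k ih =>
      intro hk
      have hsmall : ∀ i : Fin n, (i : ℕ) < k → h i ⟨k, hk⟩ = 0 := by
        intro i hi
        have h1 : h i i = 1 := by
          have := ih i hi i.2 i
          simpa using this
        have h2 := congrFun (congrFun hu' i) i
        rw [Matrix.mul_apply, Matrix.one_apply_eq] at h2
        simp only [Matrix.conjTranspose_apply, RCLike.star_def, Complex.mul_conj'] at h2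
        have h3 : ∑ j, ‖h i j‖ ^ 2 = 1 := by exact_mod_cast h2
        rw [← Finset.add_sum_erase _ _ (Finset.mem_univ i), h1] at h3
        have h4 : ∑ j ∈ Finset.univ.erase i, ‖h i j‖ ^ 2 = 0 := by
          simp at h3; simpa using h3
        rw [Finset.sum_eq_zero_iff_of_nonneg (fun _ _ => by positivity)] at h4
        have h5 := h4 ⟨k, hk⟩ (by
          simp only [Finset.mem_erase, Finset.mem_univ, and_true]
          intro hh
          rw [← hh] at hi
          simp at hi)
        simpa using h5
      intro i
      by_cases hik : (i : ℕ) < k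
      · rw [hsmall i hik, Matrix.one_apply_ne]
        intro hh
        rw [hh] at hik
        simp at hik
      · push Not at hik
        let f : Fin (k+1) → Fin n := fun a => if (a : ℕ) < k then Fin.castLE hk a else i
        have hf : StrictMono f := by
          intro a b hab
          have hab' : (a : ℕ) < b := hab
          have hb := b.2
          have ha' : (a : ℕ) < k := by omega
          simp only [f, if_pos ha']
          split_ifs
          · exact hab
          · rw [Fin.lt_def]; simp only [Fin.val_castLE]; omega
        have hdet : ∀ A : Matrix (Fin n) (Fin n) ℂ,
            (∀ j (hj : j < k) (i : Fin n), A i ⟨j, hj.trans hk⟩ =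
              (1 : Matrix (Fin n) (Fin n) ℂ) i ⟨j, hj.trans hk⟩) →
            (∀ i : Fin n, (i : ℕ) < k → A i ⟨k, hk⟩ = 0) →
            compd (k+1) A (OrderEmbedding.ofStrictMono f hf) (Fin.castLEOrderEmb hk)
              = A i ⟨k, hk⟩ := by
          intro A hA hA'
          have hup : (A.submatrix f (Fin.castLE hk)).IsUpperTriangular := by
            intro a b hab
            have hab' : (b : ℕ) < a := hab
            have hbk : (b : ℕ) < k := by omega
            refine (hA b hbk (f a)).trans (Matrix.one_apply_ne ?_)
            intro hh
            have := hf.monotone (show b ≤ a from hab.le)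
            have h3 : f b < f a := hf hab
            have h4 : f b = Fin.castLE hk b := by simp [f, hbk]
            rw [h4, hh] at h3
            exact lt_irrefl _ h3
          refine (Matrix.det_of_isUpperTriangular hup).trans ?_
          rw [Fin.prod_univ_castSucc, Finset.prod_eq_one]
          · have : f (Fin.last k) = i := by simp [f]
            rw [one_mul, Matrix.submatrix_apply, this]
            rfl
          · intro a _
            have : f a.castSucc = ⟨a, a.2.trans hk⟩ := by
              simp only [f, Fin.val_castSucc, a.2, if_true]; rfl
            rw [Matrix.submatrix_apply, this]
            refine (hA a a.2 _).trans ?_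
            simp
        have h1 := hdet h (fun j hj i => ih j hj _ i) hsmall
        have h2 := hdet 1 (fun j hj i => rfl) (fun i hi => Matrix.one_apply_ne (by
          intro hh; rw [hh] at hi; simp at hi))
        rw [← h1, ← h2]
        exact hm _ _ _
  ext i j
  exact key j j.2 i

theorem IsPosReal.conj_eq {z : ℂ} (h : IsPosReal z) : star z = z := by
  apply Complex.ext <;> simp [h.2]

theorem left_pos {n : ℕ} {g : Matrix (Fin n) (Fin n) ℂ} (hg : g ∈ UnitaryTP n) (k : ℕ)
    (hk : k ≤ n) (e : Fin k ↪o Fin n) : IsPosReal (compd k g e (Fin.castLEOrderEmb hk)) := by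
  obtain ⟨I, hI, rfl⟩ := emb_exists e
  rw [← leftMinor_eq]
  exact hg.2 I

theorem compd_map_star {n : ℕ} (k : ℕ) (g : Matrix (Fin n) (Fin n) ℂ) (e f : Fin k ↪o Fin n) :
    compd k (g.map star) e f = star (compd k g e f) := by
  have h := (starRingEnd ℂ).map_det (g.submatrix e f)
  exact h.symm

theorem real_of_tp {n : ℕ} {g : Matrix (Fin n) (Fin n) ℂ} (hg : g ∈ UnitaryTP n) :
    g.map star = g := by
  have hu : g * gᴴ = 1 := mul_eq_one_comm.1 hg.1
  have ht : (g.map star)ᴴ * (g.map star) = 1 := by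
    have h1 : (g.map star)ᴴ * (g.map star) = (gᴴ * g).map (starRingEnd ℂ) := by
      rw [Matrix.map_mul]; rfl
    rw [h1, hg.1]
    simp
  have h1 : gᴴ * g.map star = 1 := by
    apply eq_one_of_left
    · rw [Matrix.conjTranspose_mul, Matrix.conjTranspose_conjTranspose, Matrix.mul_assoc,
        ← Matrix.mul_assoc g, hu, Matrix.one_mul, ht]
    · intro k hk e
      rw [← hg.1, compd_mul, compd_mul, Matrix.mul_apply, Matrix.mul_apply]
      refine Finset.sum_congr rfl fun f _ => ?_
      rw [compd_map_star, (left_pos hg k hk f).conj_eq]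
  calc g.map star = (g * gᴴ) * g.map star := by rw [hu, Matrix.one_mul]
    _ = g := by rw [Matrix.mul_assoc, h1, Matrix.mul_one]

theorem tp_imp_eventually {n : ℕ} (lam : Fin n → ℝ)
    (hanti : StrictAnti lam) (hpos : ∀ i, 0 < lam i)
    (L g : Matrix (Fin n) (Fin n) ℂ) (hg : g ∈ UnitaryTP n)
    (hL : L = g * Matrix.diagonal (fun i => (lam i : ℂ)) * gᴴ) :
    ∃ m₀ : ℕ, ∀ m : ℕ, m₀ ≤ m → ∀ I J : Finset (Fin n), I.Nonempty → I.card = J.card →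
        IsPosReal (minorOn (L ^ m) I J) := by
  have hgr := real_of_tp hg
  have key : ∀ (k : ℕ) (e f : Fin k ↪o Fin n), ∀ᶠ m in Filter.atTop,
      IsPosReal (compd k (L ^ m) e f) := by
    intro k e f
    have hk := emb_card_le e
    set o : Fin k ↪o Fin n := Fin.castLEOrderEmb hk with ho
    set M : (Fin k ↪o Fin n) → ℝ := fun e => ∏ i, lam (e i) with hM
    have hMpos : ∀ e, 0 < M e := fun e => Finset.prod_pos fun i _ => hpos _
    set G : (Fin k ↪o Fin n) → (Fin k ↪o Fin n) → ℝ := fun e f => (compd k g e f).re with hG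
    have hGc : ∀ e f, compd k g e f = (G e f : ℂ) := by
      intro e f
      have h := compd_map_star k g e f
      rw [hgr] at h
      exact (Complex.conj_eq_iff_re.1 h.symm).symm
    have hformula : ∀ m, compd k (L ^ m) e f = ((∑ a, G e a * M a ^ m * G f a : ℝ) : ℂ) := by
      intro m
      rw [compd_pow k m lam g L hg.1 hL, Matrix.mul_apply]
      push_cast
      refine Finset.sum_congr rfl fun a _ => ?_
      rw [Matrix.mul_diagonal, Matrix.conjTranspose_apply, hGc, hGc, RCLike.star_def,
        Complex.conj_ofReal]
      simp [hM]
    have hlim : Filter.Tendsto (fun m : ℕ => ∑ a, G e a * G f a * (M a / M o) ^ m) Filter.atTop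
        (nhds (∑ a, if a = o then G e a * G f a else 0)) := by
      refine tendsto_finsetSum _ fun a _ => ?_
      by_cases hao : a = o
      · subst hao
        simp [div_self (hMpos o).ne']
      · rw [if_neg hao, ← mul_zero (G e a * G f a)]
        refine Filter.Tendsto.const_mul _ (tendsto_pow_atTop_nhds_zero_of_lt_one
          (div_pos (hMpos a) (hMpos o)).le ?_)
        rw [div_lt_one (hMpos o)]
        exact prod_lt_first lam hanti hpos a hk hao
    simp only [Finset.sum_ite_eq', Finset.mem_univ, if_true] at hlim
    have hp : 0 < G e o * G f o := mul_pos (left_pos hg k hk e).1 (left_pos hg k hk f).1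
    filter_upwards [hlim.eventually (lt_mem_nhds hp)] with m hm
    rw [hformula]
    refine ⟨?_, Complex.ofReal_im _⟩
    rw [Complex.ofReal_re]
    have : ∑ a, G e a * M a ^ m * G f a = M o ^ m * ∑ a, G e a * G f a * (M a / M o) ^ m := by
      rw [Finset.mul_sum]
      refine Finset.sum_congr rfl fun a _ => ?_
      have := (hMpos o).ne'
      rw [div_pow]
      field_simp
    rw [this]
    exact mul_pos (pow_pos (hMpos o) _) hm
  rw [← Filter.eventually_atTop]
  rw [Filter.eventually_all]; intro I
  rw [Filter.eventually_all]; intro J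
  by_cases hIJ : I.card = J.card
  · filter_upwards [key I.card (I.orderEmbOfFin rfl) (J.orderEmbOfFin hIJ.symm)] with m hm _ _
    rw [minorOn_eq _ I J rfl hIJ.symm]
    exact hm
  · exact Filter.Eventually.of_forall fun m _ h => absurd h hIJ

theorem pos_imp_tp {n : ℕ} (lam : Fin n → ℝ)
    (hanti : StrictAnti lam) (hpos : ∀ i, 0 < lam i)
    (L u : Matrix (Fin n) (Fin n) ℂ) (hu : uᴴ * u = 1)
    (hL : L = u * Matrix.diagonal (fun i => (lam i : ℂ)) * uᴴ) (m : ℕ)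
    (hm : ∀ I J : Finset (Fin n), I.Nonempty → I.card = J.card →
        IsPosReal (minorOn (L ^ m) I J)) :
    ∃ g ∈ UnitaryTP n, L = g * Matrix.diagonal (fun i => (lam i : ℂ)) * gᴴ := by
  have key : ∀ k : ℕ, ∃ c : ℂ, ‖c‖ = 1 ∧ (k = 0 → c = 1) ∧ ∀ (hk : k ≤ n) (e : Fin k ↪o Fin n),
      ∃ r : ℝ, 0 < r ∧ compd k u e (Fin.castLEOrderEmb hk) = c * r := by
    intro k
    rcases Nat.eq_zero_or_pos k with rfl | hk0
    · exact ⟨1, by simp, fun _ => rfl, fun hk e => ⟨1, one_pos, by simp [compd]⟩⟩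
    by_cases hk : k ≤ n
    swap
    · exact ⟨1, by simp, fun _ => rfl, fun hk' => absurd hk' hk⟩
    have hC : (compd k u)ᴴ * compd k u = 1 := by
      rw [← compd_conjTranspose, ← compd_mul, hu, compd_one]
    obtain ⟨c, hc, h⟩ := perron_phase (compd k u) (compd k (L ^ m))
      (fun e => (∏ i, lam (e i)) ^ m) (Fin.castLEOrderEmb hk)
      (fun e => pow_le_pow_left₀ (Finset.prod_nonneg fun i _ => (hpos _).le)
        (prod_le_first lam hanti hpos e hk) m)
      (pow_pos (Finset.prod_pos fun i _ => hpos _) _) hC (compd_pow k m lam u L hu hL) (by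
        intro e f
        obtain ⟨I, hI, rfl⟩ := emb_exists e
        obtain ⟨J, hJ, rfl⟩ := emb_exists f
        rw [← minorOn_eq]
        exact hm I J (Finset.card_pos.1 (by omega)) (by omega))
    exact ⟨c, hc, fun h0 => absurd h0 hk0.ne', fun _ e => h e⟩
  choose c hc1 hc0 hc using key
  have hcne : ∀ k, c k ≠ 0 := fun k h => by
    have := hc1 k
    rw [h] at this
    simp at this
  set t : Fin n → ℂ := fun j => c j / c (j + 1) with ht
  have htn : ∀ j, ‖t j‖ = 1 := fun j => by simp [ht, hc1]
  have htel : ∀ k, ∏ j ∈ Finset.range k, c j / c (j + 1) = 1 / c k := by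
    intro k
    induction k with
    | zero => simp [hc0 0 rfl]
    | succ k ih =>
      rw [Finset.prod_range_succ, ih]
      have := hcne k
      field_simp
  have htt : ∀ j, t j * star (t j) = 1 := fun j => by
    simp [Complex.mul_conj', htn]
  have hD : ∀ d : Fin n → ℂ, Matrix.diagonal t * Matrix.diagonal d * (Matrix.diagonal t)ᴴ
      = Matrix.diagonal d := by
    intro d
    rw [Matrix.diagonal_conjTranspose, Matrix.diagonal_mul_diagonal, Matrix.diagonal_mul_diagonal]
    congr 1
    ext j
    have := htt j
    rw [Pi.star_apply]
    linear_combination d j * this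
  refine ⟨u * Matrix.diagonal t, ⟨?_, ?_⟩, ?_⟩
  · have h1 := hD (fun _ => 1)
    rw [Matrix.diagonal_one, Matrix.mul_one] at h1
    have h2 : (Matrix.diagonal t)ᴴ * Matrix.diagonal t = 1 := mul_eq_one_comm.1 h1
    rw [Matrix.conjTranspose_mul, Matrix.mul_assoc, ← Matrix.mul_assoc uᴴ, hu, Matrix.one_mul, h2]
  · intro I
    have hk : I.card ≤ n := by simpa using Finset.card_le_univ I
    rw [leftMinor_eq _ I rfl hk, compd_mul, compd_diagonal, Matrix.mul_diagonal]
    obtain ⟨r, hr, h⟩ := hc I.card hk (I.orderEmbOfFin rfl)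
    rw [h]
    have h2 : ∏ i, t (Fin.castLEOrderEmb hk i) = 1 / c I.card := by
      rw [← htel]
      exact Fin.prod_univ_eq_prod_range (fun j => c j / c (j+1)) I.card
    rw [h2]
    have h3 : c I.card * r * (1 / c I.card) = r := by
      have := hcne I.card
      field_simp
    rw [h3]
    exact ⟨by simpa using hr, by simp⟩
  · rw [hL, Matrix.conjTranspose_mul, ← Matrix.mul_assoc, Matrix.mul_assoc u (Matrix.diagonal t),
      Matrix.mul_assoc u (_ * _), hD]


/-- (Eventually totally positive matrices.) Let `λ₁ > ⋯ > λₙ > 0` and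
let `L` be Hermitian with eigenvalues `λ` (i.e. `L = u·diag(λ)·u*` for some unitary
`u`). Then the following are equivalent: (i) `L = g·diag(λ)·g*` for some `g ∈ U_n^{>0}`;
(ii) for some `m ≥ 1`, all minors of `L^m` of every order are positive reals;
(iii) for all sufficiently large `m`, all minors of `L^m` of every order are positive
reals. -/
theorem eventually_totally_positive {n : ℕ} (lam : Fin n → ℝ)
    (hanti : StrictAnti lam) (hpos : ∀ i, 0 < lam i)
    (L : Matrix (Fin n) (Fin n) ℂ)
    (hL : ∃ u : Matrix (Fin n) (Fin n) ℂ, u.conjTranspose * u = 1 ∧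
      L = u * Matrix.diagonal (fun i => (lam i : ℂ)) * u.conjTranspose) :
    ((∃ g ∈ UnitaryTP n,
        L = g * Matrix.diagonal (fun i => (lam i : ℂ)) * g.conjTranspose) ↔
      (∃ m : ℕ, 1 ≤ m ∧ ∀ I J : Finset (Fin n), I.Nonempty → I.card = J.card →
        IsPosReal (minorOn (L ^ m) I J))) ∧
    ((∃ m : ℕ, 1 ≤ m ∧ ∀ I J : Finset (Fin n), I.Nonempty → I.card = J.card →
        IsPosReal (minorOn (L ^ m) I J)) ↔
      (∃ m₀ : ℕ, ∀ m : ℕ, m₀ ≤ m → ∀ I J : Finset (Fin n), I.Nonempty → I.card = J.card →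
        IsPosReal (minorOn (L ^ m) I J))) := by
  obtain ⟨u, hu, hLu⟩ := hL
  have h21 : (∃ m : ℕ, 1 ≤ m ∧ ∀ I J : Finset (Fin n), I.Nonempty → I.card = J.card →
      IsPosReal (minorOn (L ^ m) I J)) → ∃ g ∈ UnitaryTP n,
        L = g * Matrix.diagonal (fun i => (lam i : ℂ)) * g.conjTranspose := by
    rintro ⟨m, -, hm⟩
    exact pos_imp_tp lam hanti hpos L u hu hLu m hm
  have h13 : (∃ g ∈ UnitaryTP n,
        L = g * Matrix.diagonal (fun i => (lam i : ℂ)) * g.conjTranspose) →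
      (∃ m₀ : ℕ, ∀ m : ℕ, m₀ ≤ m → ∀ I J : Finset (Fin n), I.Nonempty → I.card = J.card →
        IsPosReal (minorOn (L ^ m) I J)) := by
    rintro ⟨g, hg, hLg⟩
    exact tp_imp_eventually lam hanti hpos L g hg hLg
  have h32 : (∃ m₀ : ℕ, ∀ m : ℕ, m₀ ≤ m → ∀ I J : Finset (Fin n), I.Nonempty →
      I.card = J.card → IsPosReal (minorOn (L ^ m) I J)) →
      (∃ m : ℕ, 1 ≤ m ∧ ∀ I J : Finset (Fin n), I.Nonempty → I.card = J.card →
        IsPosReal (minorOn (L ^ m) I J)) := by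
    rintro ⟨m₀, h⟩
    exact ⟨m₀ + 1, by omega, h _ (by omega)⟩
  exact ⟨⟨fun h => h32 (h13 h), h21⟩, ⟨fun h => h13 (h21 h), h32⟩⟩
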